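/- Let G be a forest (a graph with no cycles) with v(G) vertices, e(G) edges, and k(G) connected components. Then the magnitude of G is |G|(q) = k(G) + e(G)·(1 − q)/(1 + q) = v(G) − 2e(G)·q/(1 + q) in ℚ(q). In particular, the magnitude of a tree depends only on its number of edges. -/

import Mathlib

open scoped Classical in
/-- `q ^ d` for an extended natural number `d`, with the convention `q ^ ∞ = 0`. -/
noncomputable def qExp (d : ℕ∞) : RatFunc ℚ :=
  if d = ⊤ then 0 else RatFunc.X ^ d.toNat

/-- The matrix `Z_G(q)` whose `(x, y)` entry is `q ^ d(x, y)`. -/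
noncomputable def magMatrix {V : Type*} [Fintype V] (G : SimpleGraph V) :
    Matrix V V (RatFunc ℚ) :=
  Matrix.of fun x y => qExp (G.edist x y)

/-- The magnitude of a graph: the sum of all entries of `Z_G(q)⁻¹`. -/
noncomputable def magnitude {V : Type*} [Fintype V] [DecidableEq V] (G : SimpleGraph V) :
    RatFunc ℚ :=
  ∑ x, ∑ y, (magMatrix G)⁻¹ x y

/-- The weighting of a graph: `w_G x` is the `x`-th row sum of `Z_G(q)⁻¹`. -/
noncomputable def weighting {V : Type*} [Fintype V] [DecidableEq V] (G : SimpleGraph V)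
    (x : V) : RatFunc ℚ :=
  ∑ y, (magMatrix G)⁻¹ x y

open scoped Classical in
theorem forest_card_aux {V : Type*} [Fintype V] (G : SimpleGraph V) (hG : G.IsAcyclic) :
    Nat.card G.ConnectedComponent + Nat.card G.edgeSet = Fintype.card V := by
  have hdeg (c : G.ConnectedComponent) :
      ∑ v with G.connectedComponentMk v = c, G.degree v + 2 =
        2 * (Finset.univ.filter fun v => G.connectedComponentMk v = c).card := by
    have ht := hG.isTree_connectedComponent c
    have h1 := ht.card_edgeFinset
    have h2 := c.toSimpleGraph.sum_degrees_eq_twice_card_edges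
    have h3 : ∑ v with G.connectedComponentMk v = c, G.degree v
        = ∑ v : c, c.toSimpleGraph.degree v := by
      rw [Finset.sum_subtype (p := fun v => v ∈ c) _ (by intro x; simp; rfl)]
      refine Finset.sum_congr rfl fun v _ => ?_
      rw [← SimpleGraph.card_neighborFinset_eq_degree, ← SimpleGraph.card_neighborFinset_eq_degree]
      symm
      refine Finset.card_bij (fun a _ => a.1) ?_ ?_ ?_
      · intro a ha
        rw [SimpleGraph.mem_neighborFinset] at ha ⊢
        exact ha
      · intro a _ b _ h
        exact Subtype.ext h
      · intro b hb
        have hb' : G.Adj v.1 b := by simpa using hb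
        refine ⟨⟨b, c.mem_supp_of_adj_mem_supp v.2 hb'⟩, ?_, rfl⟩
        rw [SimpleGraph.mem_neighborFinset]
        exact hb'
    have h4 : (Finset.univ.filter fun v => G.connectedComponentMk v = c).card
        = Fintype.card c := by
      rw [Fintype.card_subtype]
      rfl
    rw [h3, h2, h4, ← h1]
    ring
  have hsum := Finset.sum_congr (rfl : (Finset.univ : Finset G.ConnectedComponent) = _)
    fun c _ => hdeg c
  have hf1 : ∑ c : G.ConnectedComponent, ∑ v with G.connectedComponentMk v = c, G.degree v =
      ∑ v, G.degree v := by
    convert Finset.sum_fiberwise Finset.univ G.connectedComponentMk (fun v => G.degree v)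
  have hf2 : ∑ c : G.ConnectedComponent,
      (Finset.univ.filter fun v => G.connectedComponentMk v = c).card = Fintype.card V := by
    rw [← Finset.card_univ]
    symm
    convert Finset.card_eq_sum_card_fiberwise (s := Finset.univ) (t := Finset.univ)
      (f := G.connectedComponentMk) (fun _ _ => Finset.mem_coe.2 (Finset.mem_univ _))
  rw [Finset.sum_add_distrib, hf1, ← Finset.mul_sum, hf2,
    G.sum_degrees_eq_twice_card_edges] at hsum
  simp only [Finset.sum_const, Finset.card_univ, smul_eq_mul] at hsum
  rw [Nat.card_eq_fintype_card, Nat.card_eq_fintype_card, ← SimpleGraph.edgeFinset_card]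
  omega

theorem one_add_X_ne_aux : (1 + RatFunc.X : RatFunc ℚ) ≠ 0 := by
  intro h
  have h1 : algebraMap (Polynomial ℚ) (RatFunc ℚ) (1 + Polynomial.X) = 0 := by simpa using h
  rw [map_eq_zero_iff _ (RatFunc.algebraMap_injective ℚ)] at h1
  simpa using congrArg (Polynomial.eval 0) h1

theorem one_sub_X_ne_aux : (1 - RatFunc.X : RatFunc ℚ) ≠ 0 := by
  intro h
  have h1 : algebraMap (Polynomial ℚ) (RatFunc ℚ) (1 - Polynomial.X) = 0 := by simpa using h
  rw [map_eq_zero_iff _ (RatFunc.algebraMap_injective ℚ)] at h1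
  simpa using congrArg (Polynomial.eval 0) h1

theorem magMatrix_reach_aux {V : Type*} [Fintype V] (G : SimpleGraph V) {x y : V}
    (h : G.Reachable x y) : magMatrix G x y = RatFunc.X ^ G.dist x y := by
  simp [magMatrix, qExp, SimpleGraph.edist_ne_top_iff_reachable.2 h, SimpleGraph.dist]

theorem magMatrix_unreach_aux {V : Type*} [Fintype V] (G : SimpleGraph V) {x y : V}
    (h : ¬ G.Reachable x y) : magMatrix G x y = 0 := by
  simp [magMatrix, qExp, SimpleGraph.edist_eq_top_of_not_reachable h]

open scoped Classical in
theorem magMatrix_nbr_aux {V : Type*} [Fintype V] (G : SimpleGraph V) (hG : G.IsAcyclic)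
    (x z : V) :
    RatFunc.X * ∑ y ∈ G.neighborFinset z, magMatrix G x y =
      (1 + ((G.degree z : RatFunc ℚ) - 1) * RatFunc.X ^ 2) * magMatrix G x z
        - (if x = z then 1 - RatFunc.X ^ 2 else 0) := by
  by_cases hr : G.Reachable x z
  · by_cases hxz : x = z
    · subst hxz
      have : ∀ y ∈ G.neighborFinset x, magMatrix G x y = RatFunc.X := by
        intro y hy
        have hy' : G.Adj x y := by simpa using hy
        rw [magMatrix_reach_aux G hy'.reachable, SimpleGraph.dist_eq_one_iff_adj.2 hy', pow_one]
      rw [Finset.sum_congr rfl this, magMatrix_reach_aux G hr]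
      simp
      ring
    · obtain ⟨p, hp, hpl⟩ := hr.exists_path_of_dist
      have hnil : ¬ p.Nil := fun h => hxz h.eq
      have hadj : G.Adj z p.penultimate := (p.adj_penultimate hnil).symm
      have hpen : G.dist x z = G.dist x p.penultimate + 1 := by
        have h1 : G.dist x p.penultimate ≤ p.dropLast.length := SimpleGraph.dist_le _
        have h2 : p.dropLast.length + 1 = p.length := by
          rw [← SimpleGraph.Walk.length_concat (h := p.adj_penultimate hnil),
            SimpleGraph.Walk.concat_dropLast]
        have := hG.dist_eq_dist_add_one_of_adj_of_reachable x hadj hr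
        omega
      have hmem : p.penultimate ∈ G.neighborFinset z := by simpa using hadj
      have hoth : ∀ y ∈ (G.neighborFinset z).erase p.penultimate,
          magMatrix G x y = RatFunc.X ^ (G.dist x z + 1) := by
        intro y hy
        rw [Finset.mem_erase, SimpleGraph.mem_neighborFinset] at hy
        have hxy : G.Reachable x y := hr.trans hy.2.reachable
        rw [magMatrix_reach_aux G hxy]
        rcases hG.dist_eq_dist_add_one_of_adj_of_reachable x hy.2 hr with h | h
        · exfalso
          obtain ⟨r, hr1, hrl⟩ := hxy.exists_path_of_dist
          have hc : (r.concat hy.2.symm).IsPath := by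
            apply SimpleGraph.Walk.isPath_of_length_eq_dist
            rw [SimpleGraph.Walk.length_concat]
            omega
          have he : p = r.concat hy.2.symm :=
            congrArg Subtype.val ((hG.subsingleton_path x z).elim ⟨p, hp⟩ ⟨_, hc⟩)
          apply hy.1
          rw [he]
          simp
        · rw [h]
      rw [← Finset.add_sum_erase _ _ hmem, Finset.sum_congr rfl hoth, Finset.sum_const,
        Finset.card_erase_of_mem hmem, SimpleGraph.card_neighborFinset_eq_degree,
        magMatrix_reach_aux G hr, magMatrix_reach_aux G (hr.trans hadj.reachable), hpen,
        if_neg hxz, nsmul_eq_mul, Nat.cast_sub, Nat.cast_one]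
      · ring
      · rw [← SimpleGraph.card_neighborFinset_eq_degree]
        exact Finset.card_pos.2 ⟨_, hmem⟩
  · have : ∀ y ∈ G.neighborFinset z, magMatrix G x y = 0 := by
      intro y hy
      have hy' : G.Adj z y := by simpa using hy
      exact magMatrix_unreach_aux G fun h => hr (h.trans hy'.symm.reachable)
    rw [Finset.sum_congr rfl this, magMatrix_unreach_aux G hr, if_neg]
    · simp
    · rintro rfl
      exact hr (SimpleGraph.Reachable.refl _)

open scoped Classical in
/-- The explicit inverse of the similarity matrix of a forest. -/
noncomputable def forestInvAux {V : Type*} [Fintype V] (G : SimpleGraph V) :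
    Matrix V V (RatFunc ℚ) :=
  Matrix.of fun y z => (1 - RatFunc.X ^ 2)⁻¹ *
    ((if y = z then 1 + ((G.degree z : RatFunc ℚ) - 1) * RatFunc.X ^ 2 else 0)
      - (if y ∈ G.neighborFinset z then RatFunc.X else 0))

theorem one_sub_sq_ne_aux : (1 - RatFunc.X ^ 2 : RatFunc ℚ) ≠ 0 := by
  have : (1 - RatFunc.X ^ 2 : RatFunc ℚ) = (1 - RatFunc.X) * (1 + RatFunc.X) := by ring
  rw [this]
  exact mul_ne_zero one_sub_X_ne_aux one_add_X_ne_aux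

theorem forestInv_mul_aux {V : Type*} [Fintype V] [DecidableEq V] (G : SimpleGraph V)
    (hG : G.IsAcyclic) : magMatrix G * forestInvAux G = 1 := by
  classical
  ext x z
  have h := magMatrix_nbr_aux G hG x z
  have hne := one_sub_sq_ne_aux
  have key : (magMatrix G * forestInvAux G) x z = (1 - RatFunc.X ^ 2)⁻¹ *
      ((1 + ((G.degree z : RatFunc ℚ) - 1) * RatFunc.X ^ 2) * magMatrix G x z
        - RatFunc.X * ∑ y ∈ G.neighborFinset z, magMatrix G x y) := by
    have e1 : (1 + ((G.degree z : RatFunc ℚ) - 1) * RatFunc.X ^ 2) * magMatrix G x z =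
        ∑ y, if y = z then
          (1 + ((G.degree z : RatFunc ℚ) - 1) * RatFunc.X ^ 2) * magMatrix G x y else 0 := by
      rw [Finset.sum_ite_eq' Finset.univ z]
      simp
    have e2 : RatFunc.X * ∑ y ∈ G.neighborFinset z, magMatrix G x y =
        ∑ y, if y ∈ G.neighborFinset z then RatFunc.X * magMatrix G x y else 0 := by
      rw [Finset.mul_sum, Finset.sum_ite_mem, Finset.univ_inter]
    rw [e1, e2, ← Finset.sum_sub_distrib, Finset.mul_sum, Matrix.mul_apply]
    refine Finset.sum_congr rfl fun y _ => ?_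
    simp only [forestInvAux, Matrix.of_apply]
    split_ifs <;> ring
  rw [key, h, sub_sub_cancel, Matrix.one_apply]
  split_ifs
  · exact inv_mul_cancel₀ hne
  · simp

theorem magnitude_forest_aux {V : Type*} [Fintype V] [DecidableEq V] (G : SimpleGraph V)
    (hG : G.IsAcyclic) :
    magnitude G = (Fintype.card V : RatFunc ℚ) -
        2 * (Nat.card G.edgeSet : RatFunc ℚ) * (RatFunc.X / (1 + RatFunc.X)) := by
  classical
  have hne := one_sub_sq_ne_aux
  have h1 := one_add_X_ne_aux
  have h2 := one_sub_X_ne_aux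
  rw [magnitude, Matrix.inv_eq_right_inv (forestInv_mul_aux G hG)]
  refine (Finset.sum_comm (f := fun x y => forestInvAux G x y)).trans ?_
  have hcol (z : V) : ∑ y, forestInvAux G y z =
      1 - (G.degree z : RatFunc ℚ) * (RatFunc.X / (1 + RatFunc.X)) := by
    have key : ∑ y, forestInvAux G y z = (1 - RatFunc.X ^ 2)⁻¹ *
        (1 + ((G.degree z : RatFunc ℚ) - 1) * RatFunc.X ^ 2
          - (G.degree z : RatFunc ℚ) * RatFunc.X) := by
      have e1 : 1 + ((G.degree z : RatFunc ℚ) - 1) * RatFunc.X ^ 2 =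
          ∑ y, if y = z then 1 + ((G.degree z : RatFunc ℚ) - 1) * RatFunc.X ^ 2 else 0 := by
        rw [Finset.sum_ite_eq' Finset.univ z, if_pos (Finset.mem_univ _)]
      have e2 : (G.degree z : RatFunc ℚ) * RatFunc.X =
          ∑ y, if y ∈ G.neighborFinset z then RatFunc.X else 0 := by
        rw [Finset.sum_ite_mem, Finset.univ_inter, Finset.sum_const,
          SimpleGraph.card_neighborFinset_eq_degree, nsmul_eq_mul]
      rw [e1, e2, ← Finset.sum_sub_distrib, Finset.mul_sum]
      refine Finset.sum_congr rfl fun y _ => ?_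
      simp only [forestInvAux, Matrix.of_apply]
      congr
    rw [key]
    have : (1 - RatFunc.X ^ 2 : RatFunc ℚ) = (1 - RatFunc.X) * (1 + RatFunc.X) := by ring
    rw [this]
    generalize (RatFunc.X : RatFunc ℚ) = q at *
    field_simp
    ring
  rw [Finset.sum_congr rfl fun z _ => hcol z, Finset.sum_sub_distrib, ← Finset.sum_mul,
    ← Nat.cast_sum, G.sum_degrees_eq_twice_card_edges, Nat.card_eq_fintype_card,
    ← SimpleGraph.edgeFinset_card]
  simp


/-- The magnitude of a forest `G` is `k(G) + e(G)·(1-q)/(1+q) = v(G) - 2e(G)·q/(1+q)`,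
where `k(G)` is the number of connected components, `e(G)` the number of edges and
`v(G)` the number of vertices. -/
theorem magnitude_forest
    {V : Type*} [Fintype V] [DecidableEq V] (G : SimpleGraph V) (hG : G.IsAcyclic) :
    magnitude G = (Nat.card G.ConnectedComponent : RatFunc ℚ) +
        (Nat.card G.edgeSet : RatFunc ℚ) * ((1 - RatFunc.X) / (1 + RatFunc.X)) ∧
    magnitude G = (Fintype.card V : RatFunc ℚ) -
        2 * (Nat.card G.edgeSet : RatFunc ℚ) * (RatFunc.X / (1 + RatFunc.X)) := by
  have h := magnitude_forest_aux G hG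
  refine ⟨?_, h⟩
  have h1 := one_add_X_ne_aux
  rw [h, ← forest_card_aux G hG, Nat.cast_add]
  generalize (RatFunc.X : RatFunc ℚ) = q at *
  field_simp
  ring
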